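/- arXiv:1802.04343 — 2 statements merged into one kernel-verified Lean document; each statement's English description precedes it below -/
import Mathlib

section
/- Define w : □ × V → V by w((0,0),(i,j)) = (i,j), w((1,1),(i,j)) = (j+1,i+1), w((1,0),(i,j)) = (j+1,j), and w((0,1),(i,j)) = (i,i+1). Then w is well defined (its values lie in V) and monotone (i.e. a functor of the associated poset categories), and it satisfies: (1) w((a,b),(i,i)) = (i+a, i+b) for every (a,b) ∈ □ and every i ∈ ℤ; (2) w((a,b),(i,j)) ∈ ∂V whenever i ≠ j; (3) w((b,a), σ(i,j)) = σ(w((a,b),(i,j))) for all (a,b) ∈ □ and (i,j) ∈ V, where σ : V → V is the order automorphism (i,j) ↦ (j+1, i+1). -/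
/-- The poset `V = {(i,j) ∈ ℤ × ℤ : |i - j| ≤ 1}`. -/
def Vset : Set (ℤ × ℤ) := {p | |p.1 - p.2| ≤ 1}

/-- The boundary `∂V = {(i,j) ∈ V : |i - j| = 1}`. -/
def bVset : Set (ℤ × ℤ) := {p | |p.1 - p.2| = 1}

/-- The square poset `□ = {0,1} × {0,1}`, realized inside `ℤ × ℤ`. -/
def Square : Set (ℤ × ℤ) := {(0, 0), (0, 1), (1, 0), (1, 1)}

/-- The shift automorphism `σ(i,j) = (j+1, i+1)` of `V`. -/
def σV (p : ℤ × ℤ) : ℤ × ℤ := (p.2 + 1, p.1 + 1)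

/-- Heller-Coley's comparison map `w : □ × V → V`. -/
def wmap (q p : ℤ × ℤ) : ℤ × ℤ :=
  if q = (0, 0) then p
  else if q = (1, 1) then (p.2 + 1, p.1 + 1)
  else if q = (1, 0) then (p.2 + 1, p.2)
  else (p.1, p.1 + 1)

/-- `w` is well defined (takes values in `V`), monotone on `□ × V`, and satisfies
(1) `w((a,b),(i,i)) = (i+a, i+b)`, (2) `w((a,b),(i,j)) ∈ ∂V` for `i ≠ j`,
(3) `w((b,a), σ(i,j)) = σ(w((a,b),(i,j)))`. -/
theorem wmap_welldefined_monotone_properties :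
    (∀ q ∈ Square, ∀ p ∈ Vset, wmap q p ∈ Vset) ∧
    (∀ q q' p p' : ℤ × ℤ, q ∈ Square → q' ∈ Square → p ∈ Vset → p' ∈ Vset →
      q ≤ q' → p ≤ p' → wmap q p ≤ wmap q' p') ∧
    (∀ a b i : ℤ, (a, b) ∈ Square → wmap (a, b) (i, i) = (i + a, i + b)) ∧
    (∀ q ∈ Square, ∀ p ∈ Vset, p.1 ≠ p.2 → wmap q p ∈ bVset) ∧
    (∀ a b : ℤ, (a, b) ∈ Square → ∀ p ∈ Vset,
      wmap (b, a) (σV p) = σV (wmap (a, b) p)) := by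
  refine ⟨?_, ?_, ?_, ?_, ?_⟩
  · rintro q (rfl | rfl | rfl | rfl) ⟨i, j⟩ hp <;>
      simp [Vset, wmap, abs_le] at hp ⊢ <;> omega
  · rintro q q' ⟨i, j⟩ ⟨i', j'⟩ (rfl | rfl | rfl | rfl) (rfl | rfl | rfl | rfl) hp hp' hq h <;>
      simp [Vset, wmap, abs_le] at hp hp' hq h ⊢ <;> omega
  · rintro a b i (h | h | h | h) <;> obtain ⟨rfl, rfl⟩ := Prod.mk.inj h <;> simp [wmap]
  · rintro q (rfl | rfl | rfl | rfl) ⟨i, j⟩ hp hne <;>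
      simp [Vset, bVset, wmap, abs_le, abs_eq] at hp hne ⊢ <;> omega
  · rintro a b (h | h | h | h) p - <;> obtain ⟨rfl, rfl⟩ := Prod.mk.inj h <;>
      simp [wmap, σV]
end

section
/- Fix i, k, l ∈ ℕ with i < l and l ≤ k. Let S = {(w,x,y,z) : (w,x) ∈ V, w ≥ i, x ≥ i, (w,x) ≠ (i,i), y ∈ ℕ, z ∈ ℕ, z ≤ y, y ≥ k, z ≥ l} with the componentwise order inherited from ℤ × ℤ × ℕ × ℕ. Define ℓ : ⌝ → S by ℓ(a,b) = (a+i, b+i, k, l), and define r : S → ⌝ by r(w,x,y,z) = (1,1) if w ≥ i+1 and x ≥ i+1, r(i+1,i,y,z) = (1,0), and r(i,i+1,y,z) = (0,1). Then ℓ and r are monotone and form a Galois connection ℓ ⊣ r: for all p ∈ ⌝ and s ∈ S, ℓ(p) ≤ s if and only if p ≤ r(s). Equivalently, the functor ℓ : ⌝ → S admits a right adjoint. -/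
/-- The poset `S = {(w,x,y,z) : (w,x) ∈ V, w ≥ i, x ≥ i, (w,x) ≠ (i,i),
z ≤ y, y ≥ k, z ≥ l}` inside `ℤ × ℤ × ℕ × ℕ`, where
`V = {(w,x) ∈ ℤ × ℤ : |w-x| ≤ 1}`. -/
def Sset (i k l : ℕ) : Set (ℤ × ℤ × ℕ × ℕ) :=
  {p | |p.1 - p.2.1| ≤ 1 ∧ (i : ℤ) ≤ p.1 ∧ (i : ℤ) ≤ p.2.1 ∧
    (p.1, p.2.1) ≠ ((i : ℤ), (i : ℤ)) ∧ p.2.2.2 ≤ p.2.2.1 ∧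
    k ≤ p.2.2.1 ∧ l ≤ p.2.2.2}

/-- The poset `⌝ = {(0,1),(1,0),(1,1)}`, realized inside `ℤ × ℤ`. -/
def Ucorner : Set (ℤ × ℤ) := {(0, 1), (1, 0), (1, 1)}

/-- The left adjoint `ℓ : ⌝ → S`, `ℓ(a,b) = (a+i, b+i, k, l)`. -/
def lmap4 (i k l : ℕ) (hlk : l ≤ k) (x : Ucorner) : Sset i k l :=
  ⟨(x.1.1 + i, x.1.2 + i, k, l), by
    obtain ⟨⟨a, b⟩, hx⟩ := x
    have h : (a = 0 ∧ b = 1) ∨ (a = 1 ∧ b = 0) ∨ (a = 1 ∧ b = 1) := by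
      simpa [Ucorner, Prod.ext_iff] using hx
    refine ⟨?_, ?_, ?_, ?_, hlk, le_rfl, le_rfl⟩ <;>
      rcases h with ⟨h1, h2⟩ | ⟨h1, h2⟩ | ⟨h1, h2⟩ <;> subst h1 <;> subst h2 <;>
        simp [Prod.ext_iff] <;> omega⟩

/-- The right adjoint `r : S → ⌝`: `(1,1)` if `w ≥ i+1` and `x ≥ i+1`,
`r(i+1,i,y,z) = (1,0)` and `r(i,i+1,y,z) = (0,1)`. -/
def rmap4 (i k l : ℕ) (s : Sset i k l) : Ucorner :=
  if (i : ℤ) + 1 ≤ s.1.1 ∧ (i : ℤ) + 1 ≤ s.1.2.1 then ⟨(1, 1), by simp [Ucorner]⟩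
  else if s.1.1 = (i : ℤ) then ⟨(0, 1), by simp [Ucorner]⟩
  else ⟨(1, 0), by simp [Ucorner]⟩

theorem rmap4_galoisConnection (i k l : ℕ) (hlk : l ≤ k) :
    GaloisConnection (lmap4 i k l hlk) (rmap4 i k l) := by
  rintro ⟨⟨a, b⟩, hp⟩ ⟨⟨w, x, y, z⟩, hs⟩
  have hab : (a = 0 ∧ b = 1) ∨ (a = 1 ∧ b = 0) ∨ (a = 1 ∧ b = 1) := by
    simpa [Ucorner, Prod.ext_iff] using hp
  obtain ⟨hwx, hw, hx, hne, -, hy, hz⟩ := hs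
  simp only [ne_eq, Prod.mk.injEq, abs_le] at hwx hw hx hne hy hz
  unfold lmap4 rmap4
  split_ifs with h₁ h₂ <;> simp only [← Subtype.coe_le_coe, Prod.mk_le_mk] <;>
    dsimp only at h₁ <;> try dsimp only at h₂
  all_goals omega

/-- For `i < l ≤ k`, `ℓ` and `r` are monotone and form a Galois connection
`ℓ ⊣ r`, i.e. the functor `ℓ : ⌝ → S` of poset categories admits a right
adjoint. -/
theorem lmap4_rmap4_galoisConnection (i k l : ℕ) (hil : i < l) (hlk : l ≤ k) :
    Monotone (lmap4 i k l hlk) ∧ Monotone (rmap4 i k l) ∧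
      GaloisConnection (lmap4 i k l hlk) (rmap4 i k l) := by
  have h := rmap4_galoisConnection i k l hlk
  exact ⟨h.monotone_l, h.monotone_u, h⟩
end
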